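/- arXiv:2212.14495 — 6 statements merged into one kernel-verified Lean document; each statement's English description precedes it below -/
import Mathlib

section
/- Let C143, C144, C234, C244 be arbitrary real numbers. On the 4-dimensional real vector space with basis y1, y2, y3, y4, the skew-symmetric bilinear bracket determined by [y1,y2]=y3, [y1,y3]=y4, [y1,y4]=C143·y3 + C144·y4, [y2,y3]=(−C144·C234 + C244)·y3 + C234·y4, [y2,y4]=C143·C234·y3 + C244·y4, [y3,y4]=0 satisfies the Jacobi identity (so it defines a Lie algebra, called ourSolDep[1]), and the 2-dimensional subspace D = span{y1,y2} is an Engel-like structure on it. -/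
/-- Bilinear extension of structure constants `c` to a bracket on `Fin 4 → ℝ`. -/
noncomputable def bk (c : Fin 4 → Fin 4 → Fin 4 → ℝ) (x y : Fin 4 → ℝ) : Fin 4 → ℝ :=
  ∑ i : Fin 4, ∑ j : Fin 4, (x i * y j) • c i j

/-- Structure constants of the Engel-normalized bracket:
`[y1,y2] = y3`, `[y1,y3] = y4`, `[y1,y4] = C14`, `[y2,y3] = C23`,
`[y2,y4] = C24`, `[y3,y4] = C34`, extended skew-symmetrically. -/
noncomputable def sc (C14 C23 C24 C34 : Fin 4 → ℝ) : Fin 4 → Fin 4 → Fin 4 → ℝ :=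
  ![![0, ![0, 0, 1, 0], ![0, 0, 0, 1], C14],
    ![-![0, 0, 1, 0], 0, C23, C24],
    ![-![0, 0, 0, 1], -C23, 0, C34],
    ![-C14, -C24, -C34, 0]]

/-- The subspace spanned by all brackets `B u v` with `u ∈ S`, `v ∈ T`. -/
noncomputable def brS (B : (Fin 4 → ℝ) → (Fin 4 → ℝ) → (Fin 4 → ℝ))
    (S T : Submodule ℝ (Fin 4 → ℝ)) : Submodule ℝ (Fin 4 → ℝ) :=
  Submodule.span ℝ {z | ∃ u ∈ S, ∃ v ∈ T, z = B u v}

/-- `D` is an Engel-like structure for the bracket `B`: `D` is 2-dimensional,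
`D[2] = D + [D,D]` is 3-dimensional and `D[3] = D[2] + [D[2],D[2]]` is 4-dimensional. -/
noncomputable def IsEngelLike (B : (Fin 4 → ℝ) → (Fin 4 → ℝ) → (Fin 4 → ℝ))
    (D : Submodule ℝ (Fin 4 → ℝ)) : Prop :=
  Module.finrank ℝ D = 2 ∧
  Module.finrank ℝ ↥(D ⊔ brS B D D) = 3 ∧
  Module.finrank ℝ ↥((D ⊔ brS B D D) ⊔ brS B (D ⊔ brS B D D) (D ⊔ brS B D D)) = 4
theorem bk_formula (a b p q r s : ℝ) (x y : Fin 4 → ℝ) :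
    bk (sc ![0, 0, a, b] ![0, 0, p, q] ![0, 0, r, s] ![0, 0, 0, 0]) x y =
      ![0, 0,
        (x 0 * y 1 - x 1 * y 0) + a * (x 0 * y 3 - x 3 * y 0) + p * (x 1 * y 2 - x 2 * y 1)
          + r * (x 1 * y 3 - x 3 * y 1),
        (x 0 * y 2 - x 2 * y 0) + b * (x 0 * y 3 - x 3 * y 0) + q * (x 1 * y 2 - x 2 * y 1)
          + s * (x 1 * y 3 - x 3 * y 1)] := by
  ext k
  fin_cases k <;> simp [bk, sc, Fin.sum_univ_four] <;> ring

theorem mem_D (x : Fin 4 → ℝ) :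
    x ∈ Submodule.span ℝ {(![1, 0, 0, 0] : Fin 4 → ℝ), ![0, 1, 0, 0]} ↔ x 2 = 0 ∧ x 3 = 0 := by
  rw [Submodule.mem_span_pair]
  constructor
  · rintro ⟨a, b, rfl⟩
    simp
  · rintro ⟨h2, h3⟩
    refine ⟨x 0, x 1, ?_⟩
    ext k
    fin_cases k <;> simp [h2, h3]

theorem mem_E (x : Fin 4 → ℝ) :
    x ∈ Submodule.span ℝ (Set.range ![(![1, 0, 0, 0] : Fin 4 → ℝ), ![0, 1, 0, 0], ![0, 0, 1, 0]])
      ↔ x 3 = 0 := by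
  rw [Submodule.mem_span_range_iff_exists_fun]
  constructor
  · rintro ⟨a, rfl⟩
    simp [Fin.sum_univ_three]
  · intro h3
    refine ⟨![x 0, x 1, x 2], ?_⟩
    ext k
    fin_cases k <;> simp [h3, Fin.sum_univ_three]

theorem ourSolDep1_lie_and_engel (C143 C144 C234 C244 : ℝ) :
    let c := sc ![0, 0, C143, C144] ![0, 0, -C144 * C234 + C244, C234]
      ![0, 0, C143 * C234, C244] ![0, 0, 0, 0]
    (∀ x y : Fin 4 → ℝ, bk c x y = -bk c y x) ∧
    (∀ x y z : Fin 4 → ℝ,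
      bk c x (bk c y z) + bk c y (bk c z x) + bk c z (bk c x y) = 0) ∧
    IsEngelLike (bk c)
      (Submodule.span ℝ {(![1, 0, 0, 0] : Fin 4 → ℝ), ![0, 1, 0, 0]}) := by
  intro c
  have hf := bk_formula C143 C144 (-C144 * C234 + C244) C234 (C143 * C234) C244
  change ∀ x y, bk c x y = _ at hf
  clear_value c
  refine ⟨?_, ?_, ?_⟩
  · intro x y
    rw [hf, hf]
    ext k
    fin_cases k <;> simp <;> ring
  · intro x y z
    simp only [hf]
    ext k
    fin_cases k <;> simp <;> ring
  · have hD2 : Submodule.span ℝ {(![1, 0, 0, 0] : Fin 4 → ℝ), ![0, 1, 0, 0]} ⊔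
        brS (bk c) (Submodule.span ℝ {(![1, 0, 0, 0] : Fin 4 → ℝ), ![0, 1, 0, 0]})
          (Submodule.span ℝ {(![1, 0, 0, 0] : Fin 4 → ℝ), ![0, 1, 0, 0]}) =
        Submodule.span ℝ
          (Set.range ![(![1, 0, 0, 0] : Fin 4 → ℝ), ![0, 1, 0, 0], ![0, 0, 1, 0]]) := by
      apply le_antisymm
      · refine sup_le ?_ (Submodule.span_le.2 ?_)
        · intro x hx
          exact (mem_E x).2 ((mem_D x).1 hx).2
        · rintro z ⟨u, hu, v, hv, rfl⟩
          rw [mem_D] at hu hv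
          rw [SetLike.mem_coe, mem_E, hf]
          simp [hu, hv]
      · rw [Submodule.span_le]
        rintro _ ⟨i, rfl⟩
        fin_cases i
        · exact Submodule.mem_sup_left ((mem_D _).2 (by simp))
        · exact Submodule.mem_sup_left ((mem_D _).2 (by simp))
        · refine Submodule.mem_sup_right (Submodule.subset_span
            ⟨![1, 0, 0, 0], (mem_D _).2 (by simp), ![0, 1, 0, 0], (mem_D _).2 (by simp), ?_⟩)
          rw [hf]
          simp
    refine ⟨?_, ?_, ?_⟩
    · have hli : LinearIndependent ℝ ![(![1, 0, 0, 0] : Fin 4 → ℝ), ![0, 1, 0, 0]] := by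
        rw [LinearIndependent.pair_iff]
        intro s t h
        exact ⟨by simpa using congrFun h 0, by simpa using congrFun h 1⟩
      have := finrank_span_eq_card hli
      rw [Matrix.range_cons_cons_empty] at this
      simpa using this
    · rw [hD2]
      have hli : LinearIndependent ℝ
          ![(![1, 0, 0, 0] : Fin 4 → ℝ), ![0, 1, 0, 0], ![0, 0, 1, 0]] := by
        rw [Fintype.linearIndependent_iff]
        intro g h i
        have h0 := congrFun h 0
        have h1 := congrFun h 1
        have h2 := congrFun h 2
        simp [Fin.sum_univ_three] at h0 h1 h2
        fin_cases i <;> simp [h0, h1, h2]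
      have := finrank_span_eq_card hli
      simpa using this
    · rw [hD2]
      have htop : Submodule.span ℝ
          (Set.range ![(![1, 0, 0, 0] : Fin 4 → ℝ), ![0, 1, 0, 0], ![0, 0, 1, 0]]) ⊔
          brS (bk c) (Submodule.span ℝ
            (Set.range ![(![1, 0, 0, 0] : Fin 4 → ℝ), ![0, 1, 0, 0], ![0, 0, 1, 0]]))
          (Submodule.span ℝ
            (Set.range ![(![1, 0, 0, 0] : Fin 4 → ℝ), ![0, 1, 0, 0], ![0, 0, 1, 0]])) = ⊤ := by
        rw [eq_top_iff]
        intro x _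
        have hx : x = ![x 0, x 1, x 2, 0] + x 3 • (![0, 0, 0, 1] : Fin 4 → ℝ) := by
          ext k
          fin_cases k <;> simp
        rw [hx]
        refine Submodule.add_mem_sup ((mem_E _).2 (by simp)) (Submodule.smul_mem _ _
          (Submodule.subset_span ⟨![1, 0, 0, 0], (mem_E _).2 (by simp),
            ![0, 0, 1, 0], (mem_E _).2 (by simp), ?_⟩))
        rw [hf]
        simp
      rw [htop, finrank_top]
      simp
end

section
/- Let g be the 4-dimensional real Lie algebra Type[1] with basis y1, y2, y3, y4 and nonzero brackets [y2,y4]=y1, [y3,y4]=y2 (all other basis brackets zero, up to skew-symmetry). For real numbers p1,...,p4, q1,...,q4, set w1 = Σ_i pi·yi, w2 = Σ_i qi·yi, w3 = [w1,w2], w4 = [w1,w3], and Det(i,j) := pi·qj − pj·qi. Then the determinant of the 4×4 matrix whose rows are the coordinates of w1, w2, w3, w4 with respect to (y1,y2,y3,y4) equals p4·Det(3,4)³. -/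
theorem engel_coefficient_type1 (L : Type*) [LieRing L] [LieAlgebra ℝ L]
    (y : Module.Basis (Fin 4) ℝ L)
    (h12 : ⁅y 0, y 1⁆ = 0)
    (h13 : ⁅y 0, y 2⁆ = 0)
    (h14 : ⁅y 0, y 3⁆ = 0)
    (h23 : ⁅y 1, y 2⁆ = 0)
    (h24 : ⁅y 1, y 3⁆ = y 0)
    (h34 : ⁅y 2, y 3⁆ = y 1)
    (p q : Fin 4 → ℝ) :
    let w1 : L := ∑ i, p i • y i
    let w2 : L := ∑ i, q i • y i
    let w3 : L := ⁅w1, w2⁆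
    let w4 : L := ⁅w1, w3⁆
    let Det : Fin 4 → Fin 4 → ℝ := fun i j => p i * q j - p j * q i
    (Matrix.of fun i j => y.repr (![w1, w2, w3, w4] i) j).det
      = p 3 * Det 2 3 ^ 3 := by
  intro w1 w2 w3 w4 Det
  have h21 : ⁅y 1, y 0⁆ = 0 := by rw [← lie_skew, h12, neg_zero]
  have h31 : ⁅y 2, y 0⁆ = 0 := by rw [← lie_skew, h13, neg_zero]
  have h41 : ⁅y 3, y 0⁆ = 0 := by rw [← lie_skew, h14, neg_zero]
  have h32 : ⁅y 2, y 1⁆ = 0 := by rw [← lie_skew, h23, neg_zero]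
  have h42 : ⁅y 3, y 1⁆ = - y 0 := by rw [← lie_skew, h24]
  have h43 : ⁅y 3, y 2⁆ = - y 1 := by rw [← lie_skew, h34]
  have e3 : w3 = Det 1 3 • y 0 + Det 2 3 • y 1 := by
    simp only [w3, w1, w2, Det, Fin.sum_univ_four, add_lie, lie_add, smul_lie, lie_smul, lie_self,
      h12, h13, h14, h23, h24, h34, h21, h31, h41, h32, h42, h43]
    module
  have e4 : w4 = (-(p 3 * Det 2 3)) • y 0 := by
    simp only [w4, e3]
    simp only [w1, Fin.sum_univ_four, add_lie, lie_add, smul_lie, lie_smul, lie_self,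
      h12, h13, h14, h23, h24, h34, h21, h31, h41, h32, h42, h43]
    module
  have hM : (Matrix.of fun i j => y.repr (![w1, w2, w3, w4] i) j) =
      !![p 0, p 1, p 2, p 3; q 0, q 1, q 2, q 3; Det 1 3, Det 2 3, 0, 0;
        -(p 3 * Det 2 3), 0, 0, 0] := by
    rw [e4, e3]
    ext i j
    fin_cases i <;> fin_cases j <;>
      simp [w1, w2, Fin.sum_univ_four, Finsupp.single_apply]
  rw [hM]
  simp [Matrix.det_succ_row_zero, Fin.sum_univ_succ, Fin.succAbove]
  simp only [Det]
  ring
end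

section
/- Let a be a real number and let g be the 4-dimensional real Lie algebra Type[2] with basis y1, y2, y3, y4 and nonzero brackets [y1,y4]=a·y1, [y2,y4]=y2, [y3,y4]=y2+y3 (all other basis brackets zero, up to skew-symmetry). For real numbers p1,...,p4, q1,...,q4, set w1 = Σ_i pi·yi, w2 = Σ_i qi·yi, w3 = [w1,w2], w4 = [w1,w3], and Det(i,j) := pi·qj − pj·qi. Then the determinant of the 4×4 matrix whose rows are the coordinates of w1, w2, w3, w4 with respect to (y1,y2,y3,y4) equals (a−1)²·p4·Det(1,4)·Det(3,4)². -/
theorem engel_coefficient_type2 (L : Type*) [LieRing L] [LieAlgebra ℝ L]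
    (y : Module.Basis (Fin 4) ℝ L) (a : ℝ)
    (h12 : ⁅y 0, y 1⁆ = 0)
    (h13 : ⁅y 0, y 2⁆ = 0)
    (h14 : ⁅y 0, y 3⁆ = a • y 0)
    (h23 : ⁅y 1, y 2⁆ = 0)
    (h24 : ⁅y 1, y 3⁆ = y 1)
    (h34 : ⁅y 2, y 3⁆ = y 1 + y 2)
    (p q : Fin 4 → ℝ) :
    let w1 : L := ∑ i, p i • y i
    let w2 : L := ∑ i, q i • y i
    let w3 : L := ⁅w1, w2⁆
    let w4 : L := ⁅w1, w3⁆
    let Det : Fin 4 → Fin 4 → ℝ := fun i j => p i * q j - p j * q i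
    (Matrix.of fun i j => y.repr (![w1, w2, w3, w4] i) j).det
      = (a - 1) ^ 2 * p 3 * Det 0 3 * Det 2 3 ^ 2 := by
  intro w1 w2 w3 w4 Det
  have h21 : ⁅y 1, y 0⁆ = 0 := by rw [← lie_skew, h12, neg_zero]
  have h31 : ⁅y 2, y 0⁆ = 0 := by rw [← lie_skew, h13, neg_zero]
  have h41 : ⁅y 3, y 0⁆ = -(a • y 0) := by rw [← lie_skew, h14]
  have h32 : ⁅y 2, y 1⁆ = 0 := by rw [← lie_skew, h23, neg_zero]
  have h42 : ⁅y 3, y 1⁆ = -y 1 := by rw [← lie_skew, h24]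
  have h43 : ⁅y 3, y 2⁆ = -(y 1 + y 2) := by rw [← lie_skew, h34]
  have key : ∀ r s : Fin 4 → ℝ, ⁅∑ i, r i • y i, ∑ i, s i • y i⁆ =
      ∑ i, (![a * (r 0 * s 3 - r 3 * s 0),
        (r 1 * s 3 - r 3 * s 1) + (r 2 * s 3 - r 3 * s 2),
        r 2 * s 3 - r 3 * s 2, 0] : Fin 4 → ℝ) i • y i := by
    intro r s
    simp only [Fin.sum_univ_four, add_lie, lie_add, smul_lie, lie_smul, lie_self,
      h12, h13, h14, h23, h24, h34, h21, h31, h41, h32, h42, h43]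
    simp
    module
  have e3 : w3 = _ := key p q
  have e4 : w4 = _ := (congrArg (fun x => ⁅w1, x⁆) e3).trans (key p _)
  have r : ∀ (s : Fin 4 → ℝ) j, y.repr (∑ i, s i • y i) j = s j := by
    intro s j
    rw [Module.Basis.repr_sum_self]
  have hM : (Matrix.of fun i j => y.repr (![w1, w2, w3, w4] i) j) =
      Matrix.of ![p, q, ![a * (p 0 * q 3 - p 3 * q 0),
        (p 1 * q 3 - p 3 * q 1) + (p 2 * q 3 - p 3 * q 2),
        p 2 * q 3 - p 3 * q 2, 0],
        ![a * (p 0 * 0 - p 3 * (a * (p 0 * q 3 - p 3 * q 0))),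
          (p 1 * 0 - p 3 * ((p 1 * q 3 - p 3 * q 1) + (p 2 * q 3 - p 3 * q 2)))
            + (p 2 * 0 - p 3 * (p 2 * q 3 - p 3 * q 2)),
          p 2 * 0 - p 3 * (p 2 * q 3 - p 3 * q 2), 0]] := by
    ext i j
    fin_cases i
    · exact r _ j
    · exact r _ j
    · exact (congrArg (fun x => y.repr x j) e3).trans (r _ j)
    · exact (congrArg (fun x => y.repr x j) e4).trans (r _ j)
  rw [hM]
  simp [Matrix.det_succ_row_zero, Fin.sum_univ_succ, Fin.succAbove, Det]
  ring
end

section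
/- Let a, b be real numbers and let g be the 4-dimensional real Lie algebra Type[5] with basis y1, y2, y3, y4 and nonzero brackets [y1,y4]=y1, [y2,y4]=a·y2, [y3,y4]=b·y3 (all other basis brackets zero, up to skew-symmetry). For real numbers p1,...,p4, q1,...,q4, set w1 = Σ_i pi·yi, w2 = Σ_i qi·yi, w3 = [w1,w2], w4 = [w1,w3], and Det(i,j) := pi·qj − pj·qi. Then the determinant of the 4×4 matrix whose rows are the coordinates of w1, w2, w3, w4 with respect to (y1,y2,y3,y4) equals (a−1)·(b−1)·(a−b)·p4·Det(1,4)·Det(2,4)·Det(3,4). -/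
theorem engel_coefficient_type5 (L : Type*) [LieRing L] [LieAlgebra ℝ L]
    (y : Module.Basis (Fin 4) ℝ L) (a b : ℝ)
    (h12 : ⁅y 0, y 1⁆ = 0)
    (h13 : ⁅y 0, y 2⁆ = 0)
    (h14 : ⁅y 0, y 3⁆ = y 0)
    (h23 : ⁅y 1, y 2⁆ = 0)
    (h24 : ⁅y 1, y 3⁆ = a • y 1)
    (h34 : ⁅y 2, y 3⁆ = b • y 2)
    (p q : Fin 4 → ℝ) :
    let w1 : L := ∑ i, p i • y i
    let w2 : L := ∑ i, q i • y i
    let w3 : L := ⁅w1, w2⁆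
    let w4 : L := ⁅w1, w3⁆
    let Det : Fin 4 → Fin 4 → ℝ := fun i j => p i * q j - p j * q i
    (Matrix.of fun i j => y.repr (![w1, w2, w3, w4] i) j).det
      = (a - 1) * (b - 1) * (a - b) * p 3 * Det 0 3 * Det 1 3 * Det 2 3 := by
  intro w1 w2 w3 w4 Det
  have h21 : ⁅y 1, y 0⁆ = 0 := by rw [← lie_skew, h12, neg_zero]
  have h31 : ⁅y 2, y 0⁆ = 0 := by rw [← lie_skew, h13, neg_zero]
  have h32 : ⁅y 2, y 1⁆ = 0 := by rw [← lie_skew, h23, neg_zero]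
  have h41 : ⁅y 3, y 0⁆ = -y 0 := by rw [← lie_skew, h14]
  have h42 : ⁅y 3, y 1⁆ = -(a • y 1) := by rw [← lie_skew, h24]
  have h43 : ⁅y 3, y 2⁆ = -(b • y 2) := by rw [← lie_skew, h34]
  have e1 : w1 = p 0 • y 0 + p 1 • y 1 + p 2 • y 2 + p 3 • y 3 := Fin.sum_univ_four _
  have e2 : w2 = q 0 • y 0 + q 1 • y 1 + q 2 • y 2 + q 3 • y 3 := Fin.sum_univ_four _
  have e3 : w3 = Det 0 3 • y 0 + (a * Det 1 3) • y 1 + (b * Det 2 3) • y 2 := by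
    change ⁅w1, w2⁆ = _
    rw [e1, e2]
    simp only [Det, add_lie, lie_add, smul_lie, lie_smul, lie_self, h12, h13, h14, h23, h24,
      h34, h21, h31, h32, h41, h42, h43]
    module
  have e4 : w4 = (-p 3 * Det 0 3) • y 0 + (-p 3 * (a * a * Det 1 3)) • y 1
      + (-p 3 * (b * b * Det 2 3)) • y 2 := by
    change ⁅w1, w3⁆ = _
    rw [e1, e3]
    simp only [add_lie, lie_add, smul_lie, lie_smul, lie_self, h12, h13, h14, h23, h24,
      h34, h21, h31, h32, h41, h42, h43]
    module
  have key : (Matrix.of fun i j => y.repr (![w1, w2, w3, w4] i) j) =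
      !![p 0, p 1, p 2, p 3; q 0, q 1, q 2, q 3;
        Det 0 3, a * Det 1 3, b * Det 2 3, 0;
        -p 3 * Det 0 3, -p 3 * (a * a * Det 1 3), -p 3 * (b * b * Det 2 3), 0] := by
    rw [e1, e2, e3, e4]
    ext i j
    fin_cases i <;> fin_cases j <;> simp [Finsupp.single_apply]
  rw [key]
  simp [Matrix.det_succ_row_zero, Fin.sum_univ_succ, Fin.succAbove, Det]
  ring
end

section
/- Let g be the 4-dimensional real Lie algebra Type[7] with basis y1, y2, y3, y4 and nonzero brackets [y1,y4]=2·y1, [y2,y3]=y1, [y2,y4]=y2, [y3,y4]=y2+y3 (all other basis brackets zero, up to skew-symmetry). For real numbers p1,...,p4, q1,...,q4, set w1 = Σ_i pi·yi, w2 = Σ_i qi·yi, w3 = [w1,w2], w4 = [w1,w3], and Det(i,j) := pi·qj − pj·qi. Then the determinant of the 4×4 matrix whose rows are the coordinates of w1, w2, w3, w4 with respect to (y1,y2,y3,y4) equals Det(3,4)²·(p4·Det(1,4) + p4·Det(2,3) + p3·Det(3,4)). -/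
noncomputable def brk7 (a b : Fin 4 → ℝ) : Fin 4 → ℝ :=
  ![2 * (a 0 * b 3 - a 3 * b 0) + (a 1 * b 2 - a 2 * b 1),
        (a 1 * b 3 - a 3 * b 1) + (a 2 * b 3 - a 3 * b 2),
        a 2 * b 3 - a 3 * b 2, 0]

theorem engel_coefficient_type7 (L : Type*) [LieRing L] [LieAlgebra ℝ L]
    (y : Module.Basis (Fin 4) ℝ L)
    (h12 : ⁅y 0, y 1⁆ = 0)
    (h13 : ⁅y 0, y 2⁆ = 0)
    (h14 : ⁅y 0, y 3⁆ = (2 : ℝ) • y 0)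
    (h23 : ⁅y 1, y 2⁆ = y 0)
    (h24 : ⁅y 1, y 3⁆ = y 1)
    (h34 : ⁅y 2, y 3⁆ = y 1 + y 2)
    (p q : Fin 4 → ℝ) :
    let w1 : L := ∑ i, p i • y i
    let w2 : L := ∑ i, q i • y i
    let w3 : L := ⁅w1, w2⁆
    let w4 : L := ⁅w1, w3⁆
    let Det : Fin 4 → Fin 4 → ℝ := fun i j => p i * q j - p j * q i
    (Matrix.of fun i j => y.repr (![w1, w2, w3, w4] i) j).det
      = Det 2 3 ^ 2 * (p 3 * Det 0 3 + p 3 * Det 1 2 + p 2 * Det 2 3) := by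
  intro w1 w2 w3 w4 Det
  have h21 : ⁅y 1, y 0⁆ = 0 := by rw [← lie_skew, h12, neg_zero]
  have h31 : ⁅y 2, y 0⁆ = 0 := by rw [← lie_skew, h13, neg_zero]
  have h41 : ⁅y 3, y 0⁆ = -((2 : ℝ) • y 0) := by rw [← lie_skew, h14]
  have h32 : ⁅y 2, y 1⁆ = -y 0 := by rw [← lie_skew, h23]
  have h42 : ⁅y 3, y 1⁆ = -y 1 := by rw [← lie_skew, h24]
  have h43 : ⁅y 3, y 2⁆ = -(y 1 + y 2) := by rw [← lie_skew, h34]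
  have key : ∀ a b : Fin 4 → ℝ, ⁅∑ i, a i • y i, ∑ i, b i • y i⁆ =
      ∑ i, brk7 a b i • y i := by
    intro a b
    simp [brk7, Fin.sum_univ_four, h12, h13, h14, h23, h24, h34, h21, h31, h41, h32, h42, h43]
    module
  have e3 : w3 = ∑ i, brk7 p q i • y i := key p q
  have e4 : w4 = ∑ i, brk7 p (brk7 p q) i • y i := (congrArg (fun z => ⁅w1, z⁆) e3).trans (key p _)
  have r : ∀ a : Fin 4 → ℝ, ∀ j, y.repr (∑ i, a i • y i) j = a j := by
    intro a j
    rw [y.repr_sum_self]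
  have hM : (Matrix.of fun i j => y.repr (![w1, w2, w3, w4] i) j) =
      Matrix.of ![p, q, brk7 p q, brk7 p (brk7 p q)] := by
    ext i j
    fin_cases i
    · exact r p j
    · exact r q j
    · exact (congrArg (fun z => y.repr z j) e3).trans (r _ j)
    · exact (congrArg (fun z => y.repr z j) e4).trans (r _ j)
  rw [hM]
  simp [brk7, Matrix.det_succ_row_zero, Fin.sum_univ_succ, Fin.succAbove, Det]
  ring
end

section
/- Let g be the 4-dimensional real Lie algebra Type[12] with basis y1, y2, y3, y4 and nonzero brackets [y1,y3]=y1, [y1,y4]=−y2, [y2,y3]=y2, [y2,y4]=y1 (all other basis brackets zero, up to skew-symmetry). For real numbers p1,...,p4, q1,...,q4, set w1 = Σ_i pi·yi, w2 = Σ_i qi·yi, w3 = [w1,w2], w4 = [w1,w3], and Det(i,j) := pi·qj − pj·qi. Then the determinant of the 4×4 matrix whose rows are the coordinates of w1, w2, w3, w4 with respect to (y1,y2,y3,y4) equals p4·Det(3,4)·(Det(1,3)² + Det(1,4)² + Det(2,3)² + Det(2,4)² + 2·Det(1,2)·Det(3,4)). -/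
theorem engel_coefficient_type12 (L : Type*) [LieRing L] [LieAlgebra ℝ L]
    (y : Module.Basis (Fin 4) ℝ L)
    (h12 : ⁅y 0, y 1⁆ = 0)
    (h13 : ⁅y 0, y 2⁆ = y 0)
    (h14 : ⁅y 0, y 3⁆ = -y 1)
    (h23 : ⁅y 1, y 2⁆ = y 1)
    (h24 : ⁅y 1, y 3⁆ = y 0)
    (h34 : ⁅y 2, y 3⁆ = 0)
    (p q : Fin 4 → ℝ) :
    let w1 : L := ∑ i, p i • y i
    let w2 : L := ∑ i, q i • y i
    let w3 : L := ⁅w1, w2⁆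
    let w4 : L := ⁅w1, w3⁆
    let Det : Fin 4 → Fin 4 → ℝ := fun i j => p i * q j - p j * q i
    (Matrix.of fun i j => y.repr (![w1, w2, w3, w4] i) j).det
      = p 3 * Det 2 3 * (Det 0 2 ^ 2 + Det 0 3 ^ 2 + Det 1 2 ^ 2 + Det 1 3 ^ 2 + 2 * Det 0 1 * Det 2 3) := by
  intro w1 w2 w3 w4 Det
  have h21 : ⁅y 1, y 0⁆ = 0 := by rw [← lie_skew, h12, neg_zero]
  have h31 : ⁅y 2, y 0⁆ = -y 0 := by rw [← lie_skew, h13]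
  have h41 : ⁅y 3, y 0⁆ = y 1 := by rw [← lie_skew, h14, neg_neg]
  have h32 : ⁅y 2, y 1⁆ = -y 1 := by rw [← lie_skew, h23]
  have h42 : ⁅y 3, y 1⁆ = -y 0 := by rw [← lie_skew, h24]
  have h43 : ⁅y 3, y 2⁆ = 0 := by rw [← lie_skew, h34, neg_zero]
  have e1 : w1 = p 0 • y 0 + p 1 • y 1 + p 2 • y 2 + p 3 • y 3 := by
    simp only [w1, Fin.sum_univ_four]
  have e2 : w2 = q 0 • y 0 + q 1 • y 1 + q 2 • y 2 + q 3 • y 3 := by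
    simp only [w2, Fin.sum_univ_four]
  have e3 : w3 = (Det 0 2 + Det 1 3) • y 0 + (Det 1 2 - Det 0 3) • y 1 := by
    simp only [w3, e1, e2, Det, add_lie, lie_add, smul_lie, lie_smul, lie_self, h12, h13, h14, h23,
      h24, h34, h21, h31, h41, h32, h42, h43]
    module
  have e4 : w4 = (-(p 2 * (Det 0 2 + Det 1 3)) - p 3 * (Det 1 2 - Det 0 3)) • y 0
      + (p 3 * (Det 0 2 + Det 1 3) - p 2 * (Det 1 2 - Det 0 3)) • y 1 := by
    simp only [w4, e3, e1, add_lie, lie_add, smul_lie, lie_smul, lie_self, h12, h13, h14, h23,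
      h24, h34, h21, h31, h41, h32, h42, h43]
    module
  have hM : (Matrix.of fun i j => y.repr (![w1, w2, w3, w4] i) j) =
      !![p 0, p 1, p 2, p 3; q 0, q 1, q 2, q 3;
        Det 0 2 + Det 1 3, Det 1 2 - Det 0 3, 0, 0;
        -(p 2 * (Det 0 2 + Det 1 3)) - p 3 * (Det 1 2 - Det 0 3),
        p 3 * (Det 0 2 + Det 1 3) - p 2 * (Det 1 2 - Det 0 3), 0, 0] := by
    rw [e4, e3, e2, e1]
    ext i j
    fin_cases i <;> fin_cases j <;> simp [Finsupp.single_apply]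
  rw [hM]
  simp [Matrix.det_succ_row_zero, Fin.sum_univ_succ, Fin.succAbove, Det]
  ring
end
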